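/- Let v : ℝ² → ℝ be a smooth function of the variables (t,x) that solves the Burgers equation ∂_t v + v·∂_x v = ∂_x² v. Then for every smooth function f : ℝ² → ℝ one has M_v(P̂ f) = P̂(M_v f); that is, the operator P̂ = ∂_x − v/2 commutes with the operator M_v = ∂_t + v·∂_x − ∂_x² on solutions of the Burgers equation. -/

import Mathlib

/-- The operator `P̂ = ∂ₓ − v/2` associated with `v`. -/
noncomputable def burgP (v f : ℝ → ℝ → ℝ) : ℝ → ℝ → ℝ :=
  fun t x => deriv (f t) x - (1 / 2) * v t x * f t x

/-- The operator `Ĝ = t P̂ + x/2` associated with `v`. -/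
noncomputable def burgG (v f : ℝ → ℝ → ℝ) : ℝ → ℝ → ℝ :=
  fun t x => t * burgP v f t x + x / 2 * f t x

/-- The operator `M_v = ∂ₜ + v ∂ₓ − ∂ₓ²` associated with `v`. -/
noncomputable def burgM (v f : ℝ → ℝ → ℝ) : ℝ → ℝ → ℝ :=
  fun t x => deriv (fun s => f s x) t + v t x * deriv (f t) x - deriv (deriv (f t)) x

theorem hasDerivAt_snd_of_differentiable {g : ℝ → ℝ → ℝ}
    (hg : Differentiable ℝ (Function.uncurry g)) (t x : ℝ) :
    HasDerivAt (g t) (fderiv ℝ (Function.uncurry g) (t, x) (0, 1)) x :=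
  (hg (t, x)).hasFDerivAt.comp_hasDerivAt x ((hasDerivAt_const x t).prodMk (hasDerivAt_id x))

theorem hasDerivAt_fst_of_differentiable {g : ℝ → ℝ → ℝ}
    (hg : Differentiable ℝ (Function.uncurry g)) (t x : ℝ) :
    HasDerivAt (fun s => g s x) (fderiv ℝ (Function.uncurry g) (t, x) (1, 0)) t :=
  (hg (t, x)).hasFDerivAt.comp_hasDerivAt (f := fun s => (s, x)) t
    ((hasDerivAt_id' t).prodMk (hasDerivAt_const t x))

theorem contDiff_fderiv_apply_const {g : ℝ × ℝ → ℝ} (hg : ContDiff ℝ (⊤ : ℕ∞) g) (w : ℝ × ℝ) :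
    ContDiff ℝ (⊤ : ℕ∞) (fun p => fderiv ℝ g p w) :=
  (hg.fderiv_right (m := (⊤ : ℕ∞)) (by norm_cast)).clm_apply contDiff_const

theorem contDiff_uncurry_deriv_snd {g : ℝ → ℝ → ℝ}
    (hg : ContDiff ℝ (⊤ : ℕ∞) (Function.uncurry g)) :
    ContDiff ℝ (⊤ : ℕ∞) (Function.uncurry fun t x => deriv (g t) x) := by
  convert contDiff_fderiv_apply_const hg (0, 1) using 1
  ext ⟨t, x⟩
  exact (hasDerivAt_snd_of_differentiable (hg.differentiable (by simp)) t x).deriv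

theorem contDiff_uncurry_deriv_fst {g : ℝ → ℝ → ℝ}
    (hg : ContDiff ℝ (⊤ : ℕ∞) (Function.uncurry g)) :
    ContDiff ℝ (⊤ : ℕ∞) (Function.uncurry fun t x => deriv (fun s => g s x) t) := by
  convert contDiff_fderiv_apply_const hg (1, 0) using 1
  ext ⟨t, x⟩
  exact (hasDerivAt_fst_of_differentiable (hg.differentiable (by simp)) t x).deriv

theorem hasDerivAt_deriv_snd {g : ℝ → ℝ → ℝ}
    (hg : ContDiff ℝ (⊤ : ℕ∞) (Function.uncurry g)) (t x : ℝ) :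
    HasDerivAt (g t) (deriv (g t) x) x :=
  (hasDerivAt_snd_of_differentiable (hg.differentiable (by simp)) t x).differentiableAt.hasDerivAt

theorem hasDerivAt_deriv_fst {g : ℝ → ℝ → ℝ}
    (hg : ContDiff ℝ (⊤ : ℕ∞) (Function.uncurry g)) (t x : ℝ) :
    HasDerivAt (fun s => g s x) (deriv (fun s => g s x) t) t :=
  (hasDerivAt_fst_of_differentiable (hg.differentiable (by simp)) t x).differentiableAt.hasDerivAt

/-- The mixed partial derivatives of a smooth function of two real variables agree. -/
theorem deriv_fst_deriv_snd_comm {g : ℝ → ℝ → ℝ}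
    (hg : ContDiff ℝ (⊤ : ℕ∞) (Function.uncurry g)) (t x : ℝ) :
    deriv (fun s => deriv (g s) x) t = deriv (fun y => deriv (fun s => g s y) t) x := by
  have hd : Differentiable ℝ (Function.uncurry g) := hg.differentiable (by simp)
  have hdd : DifferentiableAt ℝ (fderiv ℝ (Function.uncurry g)) (t, x) :=
    (hg.fderiv_right (m := (⊤ : ℕ∞)) (by norm_cast)).differentiable (by simp) _
  have hsymm : IsSymmSndFDerivAt ℝ (Function.uncurry g) (t, x) :=
    hg.contDiffAt.isSymmSndFDerivAt (by simp; norm_cast)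
  have hx : (fun s => deriv (g s) x) =
      fun s => fderiv ℝ (Function.uncurry g) (s, x) (0, 1) :=
    funext fun s => (hasDerivAt_snd_of_differentiable hd s x).deriv
  have ht : (fun y => deriv (fun s => g s y) t) =
      fun y => fderiv ℝ (Function.uncurry g) (t, y) (1, 0) :=
    funext fun y => (hasDerivAt_fst_of_differentiable hd t y).deriv
  have h1 : HasDerivAt (fun s => fderiv ℝ (Function.uncurry g) (s, x))
      (fderiv ℝ (fderiv ℝ (Function.uncurry g)) (t, x) (1, 0)) t :=
    hdd.hasFDerivAt.comp_hasDerivAt (f := fun s => (s, x)) t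
      ((hasDerivAt_id' t).prodMk (hasDerivAt_const t x))
  have h2 : HasDerivAt (fun y => fderiv ℝ (Function.uncurry g) (t, y))
      (fderiv ℝ (fderiv ℝ (Function.uncurry g)) (t, x) (0, 1)) x :=
    hdd.hasFDerivAt.comp_hasDerivAt (f := fun y => (t, y)) x
      ((hasDerivAt_const x t).prodMk (hasDerivAt_id' x))
  rw [hx, ht]
  rw [(h1.clm_apply (hasDerivAt_const t ((0, 1) : ℝ × ℝ))).deriv,
    (h2.clm_apply (hasDerivAt_const x ((1, 0) : ℝ × ℝ))).deriv]
  simpa using hsymm.eq (1, 0) (0, 1)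

/-- If a smooth `v : ℝ² → ℝ` solves the Burgers equation `∂ₜ v + v ∂ₓ v = ∂ₓ² v`, then
for every smooth `f`, `M_v(P̂ f) = P̂(M_v f)`: the operator `P̂ = ∂ₓ − v/2` commutes
with `M_v = ∂ₜ + v ∂ₓ − ∂ₓ²` on solutions of the Burgers equation. -/
theorem burgers_Phat_commutes_with_M
    (v : ℝ → ℝ → ℝ)
    (hv : ContDiff ℝ (⊤ : ℕ∞) (Function.uncurry v))
    (hburg : ∀ t x, deriv (fun s => v s x) t + v t x * deriv (v t) x
        = deriv (deriv (v t)) x)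
    (f : ℝ → ℝ → ℝ)
    (hf : ContDiff ℝ (⊤ : ℕ∞) (Function.uncurry f)) :
    ∀ t x, burgM v (burgP v f) t x = burgP v (burgM v f) t x := by
  intro t x
  have hfx := contDiff_uncurry_deriv_snd hf
  have hfxx := contDiff_uncurry_deriv_snd hfx
  have hft := contDiff_uncurry_deriv_fst hf
  have hvx := contDiff_uncurry_deriv_snd hv
  have hPx : deriv (burgP v f t) = fun y => deriv (deriv (f t)) y
      - (1 / 2 * deriv (v t) y * f t y + 1 / 2 * v t y * deriv (f t) y) :=
    funext fun y => ((hasDerivAt_deriv_snd hfx t y).sub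
      (((hasDerivAt_deriv_snd hv t y).const_mul (1 / 2)).mul (hasDerivAt_deriv_snd hf t y))).deriv
  have hPxx := ((hasDerivAt_deriv_snd hfxx t x).sub
    ((((hasDerivAt_deriv_snd hvx t x).const_mul (1 / 2)).mul (hasDerivAt_deriv_snd hf t x)).add
      (((hasDerivAt_deriv_snd hv t x).const_mul (1 / 2)).mul
        (hasDerivAt_deriv_snd hfx t x)))).deriv
  have hPt : deriv (fun s => burgP v f s x) t = _ := ((hasDerivAt_deriv_fst hfx t x).sub
    (((hasDerivAt_deriv_fst hv t x).const_mul (1 / 2)).mul (hasDerivAt_deriv_fst hf t x))).deriv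
  have hMx : deriv (burgM v f t) x = _ := (((hasDerivAt_deriv_snd hft t x).add
    ((hasDerivAt_deriv_snd hv t x).mul (hasDerivAt_deriv_snd hfx t x))).sub
      (hasDerivAt_deriv_snd hfxx t x)).deriv
  replace hPxx : deriv (deriv (burgP v f t)) x = _ := (congrArg (deriv · x) hPx).trans hPxx
  rw [burgM, burgP.eq_def v (burgM v f), hPt, hPxx, hMx, hPx, burgM,
    deriv_fst_deriv_snd_comm hf]
  simp only
  linear_combination (-(1 / 2) * f t x) * hburg t x
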